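/- Let H satisfy Assumption (H), let H̄ be its decreasing envelope, let κ be a decreasing L1-kernel which is not identically zero, and let a : [0,∞) → (w_*, w_max] be continuous and increasing. Then the nonlinear Volterra equation f(t) = a(t) + ∫₀^t κ(t−s) H(f(s)) ds has a unique global continuous solution f on [0,∞), and this solution satisfies w_* < Q̄₁⁻¹(∫₀^t κ(s) ds, a(0)) ≤ f(t) < a(t) for all t > 0, where Q̄₁(w,a₀) = −∫_w^{a₀} dζ/H̄(ζ). -/

import Mathlib

open MeasureTheory Set Filter

/-- Assumption (H): `H : (−∞, w_max] → ℝ` (modeled on all of `ℝ`, with all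
conditions imposed on `(−∞, w_max]`) is continuously differentiable and convex,
has a unique root `w_*` in `(−∞, w_max]`, `H′(w_*) < 0` and `H(w_max) < 0`. -/
def AssumptionH (wmax wstar : ℝ) (H : ℝ → ℝ) : Prop :=
  wstar ≤ wmax ∧
  ContDiffOn ℝ 1 H (Set.Iic wmax) ∧
  ConvexOn ℝ (Set.Iic wmax) H ∧
  H wstar = 0 ∧
  (∀ w ∈ Set.Iic wmax, H w = 0 → w = wstar) ∧
  derivWithin H (Set.Iic wmax) wstar < 0 ∧
  H wmax < 0

/-- An `L_p`-kernel: nonnegative on `[0,∞)`, continuous on `(0,∞)`,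
with `∫₀^T κ(t)^p dt < ∞` for all `T > 0`. -/
def IsLpKernel (p : ℝ) (κ : ℝ → ℝ) : Prop :=
  (∀ t, 0 ≤ t → 0 ≤ κ t) ∧ ContinuousOn κ (Set.Ioi 0) ∧
    ∀ T > 0, MeasureTheory.IntegrableOn (fun t => κ t ^ p) (Set.Ioc 0 T)

theorem laplace_integrableOn {κ : ℝ → ℝ} (hκ0 : ∀ s > 0, 0 ≤ κ s)
    (hκc : ContinuousOn κ (Ioi 0)) (hκi : ∀ T > 0, IntegrableOn κ (Ioc 0 T))
    (hdec : AntitoneOn κ (Ioi 0)) {l : ℝ} (hl : 0 < l) :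
    IntegrableOn (fun s => κ s * Real.exp (-(l * s))) (Ioi 0) := by
  have hm : ∀ S : Set ℝ, MeasurableSet S → S ⊆ Ioi 0 →
      AEStronglyMeasurable (fun s => κ s * Real.exp (-(l * s))) (volume.restrict S) := by
    intro S hS hS0
    refine ContinuousOn.aestronglyMeasurable ?_ hS
    exact (hκc.mono hS0).mul (by fun_prop)
  rw [← Ioc_union_Ioi_eq_Ioi (zero_le_one' ℝ)]
  refine IntegrableOn.union ?_ ?_
  · refine Integrable.mono (hκi 1 one_pos) (hm _ measurableSet_Ioc Ioc_subset_Ioi_self) ?_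
    refine (ae_restrict_mem measurableSet_Ioc).mono fun s hs => ?_
    rw [norm_mul]
    refine mul_le_of_le_one_right (norm_nonneg _) ?_
    rw [Real.norm_eq_abs, Real.abs_exp, Real.exp_le_one_iff]
    nlinarith [hs.1]
  · have h1 : IntegrableOn (fun s => κ 1 * Real.exp (-l * s)) (Ioi 1) :=
      (exp_neg_integrableOn_Ioi 1 hl).const_mul _
    refine Integrable.mono h1
      (hm _ measurableSet_Ioi (Ioi_subset_Ioi zero_le_one)) ?_
    refine (ae_restrict_mem measurableSet_Ioi).mono fun s hs => ?_
    have hs1 : (1 : ℝ) < s := hs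
    have hs0 : 0 < s := by linarith
    rw [norm_mul, norm_mul, Real.norm_of_nonneg (hκ0 s hs0), Real.norm_of_nonneg (hκ0 1 one_pos),
      neg_mul]
    exact mul_le_mul_of_nonneg_right (hdec (mem_Ioi.2 one_pos) hs0 hs1.le) (norm_nonneg _)

theorem laplace_tendsto_zero {κ : ℝ → ℝ} (hκ0 : ∀ s > 0, 0 ≤ κ s)
    (hκc : ContinuousOn κ (Ioi 0)) (hκi : ∀ T > 0, IntegrableOn κ (Ioc 0 T))
    (hdec : AntitoneOn κ (Ioi 0)) :
    Tendsto (fun l : ℝ => ∫ s in Ioi (0 : ℝ), κ s * Real.exp (-(l * s))) atTop (nhds 0) := by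
  suffices h : Tendsto (fun l : ℝ => ∫ s in Ioi (0 : ℝ), κ s * Real.exp (-(l * s))) atTop
      (nhds (∫ s in Ioi (0 : ℝ), (0 : ℝ))) by simpa using h
  refine tendsto_integral_filter_of_dominated_convergence
    (fun s => κ s * Real.exp (-(1 * s))) ?_ ?_
    (laplace_integrableOn hκ0 hκc hκi hdec one_pos) ?_
  · filter_upwards [eventually_gt_atTop 0] with l hl
    exact (laplace_integrableOn hκ0 hκc hκi hdec hl).1
  · filter_upwards [eventually_ge_atTop 1] with l hl
    refine (ae_restrict_mem measurableSet_Ioi).mono fun s hs => ?_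
    have hs0 : (0 : ℝ) < s := hs
    rw [norm_mul, Real.norm_of_nonneg (hκ0 s hs0), Real.norm_of_nonneg (Real.exp_pos _).le]
    refine mul_le_mul_of_nonneg_left (Real.exp_le_exp.2 ?_) (hκ0 s hs0)
    nlinarith
  · refine (ae_restrict_mem measurableSet_Ioi).mono fun s hs => ?_
    have hs0 : (0 : ℝ) < s := hs
    have : Tendsto (fun l : ℝ => Real.exp (-(l * s))) atTop (nhds 0) :=
      Real.tendsto_exp_neg_atTop_nhds_zero.comp (tendsto_id.atTop_mul_const hs0)
    simpa using this.const_mul (κ s)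

/-- The convolution term of the Volterra equation in the exponentially weighted unknown
`u t = exp (-(l * t)) * f t`. -/
noncomputable def weightedConv (κ G : ℝ → ℝ) (l : ℝ) (u : ℝ → ℝ) (t : ℝ) : ℝ :=
  ∫ s in Ioi (0 : ℝ), κ s * Real.exp (-(l * s)) *
    (if s < t then Real.exp (-(l * (t - s))) * G (Real.exp (l * (t - s)) * u (t - s)) else 0)

section weightedConv

variable {κ G : ℝ → ℝ} {l M : ℝ} {u v : ℝ → ℝ}

theorem norm_weightedConv_integrand_le (hκ0 : ∀ s > 0, 0 ≤ κ s) (hl : 0 < l)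
    (hM : ∀ x, |G x| ≤ M) (t s : ℝ) (hs : 0 < s) :
    ‖κ s * Real.exp (-(l * s)) *
      (if s < t then Real.exp (-(l * (t - s))) * G (Real.exp (l * (t - s)) * u (t - s)) else 0)‖
      ≤ κ s * Real.exp (-(l * s)) * M := by
  have hM0 : 0 ≤ M := (abs_nonneg _).trans (hM 0)
  have hk : 0 ≤ κ s * Real.exp (-(l * s)) := mul_nonneg (hκ0 s hs) (Real.exp_pos _).le
  rw [norm_mul, Real.norm_of_nonneg hk]
  refine mul_le_mul_of_nonneg_left ?_ hk
  split_ifs with h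
  · rw [norm_mul, Real.norm_of_nonneg (Real.exp_pos _).le, ← one_mul M]
    refine mul_le_mul ?_ (hM _) (norm_nonneg _) zero_le_one
    rw [Real.exp_le_one_iff]
    nlinarith
  · simpa using hM0

theorem aestronglyMeasurable_weightedConv_integrand
    (hκc : ContinuousOn κ (Ioi 0)) (hG : Continuous G) (hu : Continuous u) (t : ℝ) :
    AEStronglyMeasurable (fun s => κ s * Real.exp (-(l * s)) *
      (if s < t then Real.exp (-(l * (t - s))) * G (Real.exp (l * (t - s)) * u (t - s)) else 0))
      (volume.restrict (Ioi 0)) := by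
  refine AEStronglyMeasurable.mul ?_ ?_
  · exact (hκc.mul (by fun_prop)).aestronglyMeasurable measurableSet_Ioi
  · refine Measurable.aestronglyMeasurable ?_
    exact Measurable.ite measurableSet_Iio (Continuous.measurable (by fun_prop)) measurable_const

theorem integrableOn_weightedConv_integrand (hκ0 : ∀ s > 0, 0 ≤ κ s)
    (hκc : ContinuousOn κ (Ioi 0)) (hκi : ∀ T > 0, IntegrableOn κ (Ioc 0 T))
    (hdec : AntitoneOn κ (Ioi 0)) (hl : 0 < l) (hG : Continuous G) (hM : ∀ x, |G x| ≤ M)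
    (hu : Continuous u) (t : ℝ) :
    IntegrableOn (fun s => κ s * Real.exp (-(l * s)) *
      (if s < t then Real.exp (-(l * (t - s))) * G (Real.exp (l * (t - s)) * u (t - s)) else 0))
      (Ioi 0) := by
  refine Integrable.mono' ((laplace_integrableOn hκ0 hκc hκi hdec hl).mul_const M)
    (aestronglyMeasurable_weightedConv_integrand hκc hG hu t) ?_
  exact (ae_restrict_mem measurableSet_Ioi).mono fun s hs =>
    norm_weightedConv_integrand_le hκ0 hl hM t s hs

theorem continuous_weightedConv (hκ0 : ∀ s > 0, 0 ≤ κ s)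
    (hκc : ContinuousOn κ (Ioi 0)) (hκi : ∀ T > 0, IntegrableOn κ (Ioc 0 T))
    (hdec : AntitoneOn κ (Ioi 0)) (hl : 0 < l) (hG : Continuous G) (hM : ∀ x, |G x| ≤ M)
    (hu : Continuous u) : Continuous (weightedConv κ G l u) := by
  rw [continuous_iff_continuousAt]
  intro t
  refine continuousAt_of_dominated (bound := fun s => κ s * Real.exp (-(l * s)) * M)
    (Eventually.of_forall fun x => aestronglyMeasurable_weightedConv_integrand hκc hG hu x)
    (Eventually.of_forall fun x => (ae_restrict_mem measurableSet_Ioi).mono fun s hs =>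
      norm_weightedConv_integrand_le hκ0 hl hM x s hs)
    ((laplace_integrableOn hκ0 hκc hκi hdec hl).mul_const M) ?_
  have hne : ∀ᵐ s ∂(volume.restrict (Ioi (0 : ℝ))), s ≠ t :=
    ae_restrict_of_ae (by simp [ae_iff])
  filter_upwards [hne] with s hs
  refine ContinuousAt.mul continuousAt_const ?_
  rcases lt_or_gt_of_ne hs with h | h
  · have he : (fun x => if s < x then
        Real.exp (-(l * (x - s))) * G (Real.exp (l * (x - s)) * u (x - s)) else 0) =ᶠ[nhds t]
        fun x => Real.exp (-(l * (x - s))) * G (Real.exp (l * (x - s)) * u (x - s)) := by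
      filter_upwards [lt_mem_nhds h] with x hx
      rw [if_pos hx]
    refine ContinuousAt.congr ?_ he.symm
    exact Continuous.continuousAt (by fun_prop)
  · have he : (fun x => if s < x then
        Real.exp (-(l * (x - s))) * G (Real.exp (l * (x - s)) * u (x - s)) else 0) =ᶠ[nhds t]
        fun _ => 0 := by
      filter_upwards [gt_mem_nhds h] with x hx
      rw [if_neg (not_lt.2 hx.le)]
    exact ContinuousAt.congr continuousAt_const he.symm

theorem norm_weightedConv_le (hκ0 : ∀ s > 0, 0 ≤ κ s)
    (hκc : ContinuousOn κ (Ioi 0)) (hκi : ∀ T > 0, IntegrableOn κ (Ioc 0 T))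
    (hdec : AntitoneOn κ (Ioi 0)) (hl : 0 < l) (hM : ∀ x, |G x| ≤ M) (t : ℝ) :
    ‖weightedConv κ G l u t‖ ≤ ∫ s in Ioi (0 : ℝ), κ s * Real.exp (-(l * s)) * M :=
  norm_integral_le_of_norm_le ((laplace_integrableOn hκ0 hκc hκi hdec hl).mul_const M)
    ((ae_restrict_mem measurableSet_Ioi).mono fun s hs =>
      norm_weightedConv_integrand_le hκ0 hl hM t s hs)

theorem dist_weightedConv_le (hκ0 : ∀ s > 0, 0 ≤ κ s)
    (hκc : ContinuousOn κ (Ioi 0)) (hκi : ∀ T > 0, IntegrableOn κ (Ioc 0 T))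
    (hdec : AntitoneOn κ (Ioi 0)) (hl : 0 < l) (hG : Continuous G) (hM : ∀ x, |G x| ≤ M)
    {C D : ℝ} (hC0 : 0 ≤ C) (hC : ∀ x y, |G x - G y| ≤ C * |x - y|)
    (hu : Continuous u) (hv : Continuous v) (huv : ∀ t, |u t - v t| ≤ D) (t : ℝ) :
    |weightedConv κ G l u t - weightedConv κ G l v t| ≤
      (∫ s in Ioi (0 : ℝ), κ s * Real.exp (-(l * s))) * (C * D) := by
  have hD0 : 0 ≤ D := (abs_nonneg _).trans (huv 0)
  unfold weightedConv
  rw [← Real.norm_eq_abs, ← integral_sub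
    (integrableOn_weightedConv_integrand hκ0 hκc hκi hdec hl hG hM hu t)
    (integrableOn_weightedConv_integrand hκ0 hκc hκi hdec hl hG hM hv t), ← integral_mul_const]
  refine norm_integral_le_of_norm_le ((laplace_integrableOn hκ0 hκc hκi hdec hl).mul_const _)
    ((ae_restrict_mem measurableSet_Ioi).mono fun s hs => ?_)
  have hk : 0 ≤ κ s * Real.exp (-(l * s)) := mul_nonneg (hκ0 s hs) (Real.exp_pos _).le
  rw [← mul_sub, norm_mul, Real.norm_of_nonneg hk]
  refine mul_le_mul_of_nonneg_left ?_ hk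
  split_ifs with h
  · rw [← mul_sub, norm_mul, Real.norm_of_nonneg (Real.exp_pos _).le, Real.norm_eq_abs]
    calc Real.exp (-(l * (t - s))) * |G (Real.exp (l * (t - s)) * u (t - s))
            - G (Real.exp (l * (t - s)) * v (t - s))|
        ≤ Real.exp (-(l * (t - s))) * (C * (Real.exp (l * (t - s)) * |u (t - s) - v (t - s)|)) := by
          refine mul_le_mul_of_nonneg_left ((hC _ _).trans_eq ?_) (Real.exp_pos _).le
          rw [← mul_sub, abs_mul, Real.abs_exp]
      _ = (Real.exp (-(l * (t - s))) * Real.exp (l * (t - s))) * (C * |u (t - s) - v (t - s)|) := by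
          ring
      _ = C * |u (t - s) - v (t - s)| := by
          rw [← Real.exp_add]; simp
      _ ≤ C * D := mul_le_mul_of_nonneg_left (huv _) hC0
  · simpa using mul_nonneg hC0 hD0

theorem weightedConv_of_nonpos {t : ℝ} (ht : t ≤ 0) : weightedConv κ G l u t = 0 := by
  unfold weightedConv
  refine setIntegral_eq_zero_of_forall_eq_zero fun s hs => ?_
  have hs0 : (0 : ℝ) < s := hs
  rw [if_neg (by linarith), mul_zero]

theorem weightedConv_eq {t : ℝ} (ht : 0 ≤ t) {f : ℝ → ℝ}
    (hf : ∀ s ≥ 0, u s = Real.exp (-(l * s)) * f s) :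
    weightedConv κ G l u t = Real.exp (-(l * t)) * ∫ s in (0 : ℝ)..t, κ (t - s) * G (f s) := by
  have h1 : ∫ s in (0 : ℝ)..t, κ (t - s) * G (f s) = ∫ s in (0 : ℝ)..t, κ s * G (f (t - s)) := by
    have := intervalIntegral.integral_comp_sub_left (a := 0) (b := t)
      (fun s => κ (t - s) * G (f s)) t
    simp only [sub_sub_cancel, sub_zero, sub_self] at this
    exact this.symm
  rw [h1, intervalIntegral.integral_of_le ht, integral_Ioc_eq_integral_Ioo, ← integral_const_mul]
  unfold weightedConv
  have h2 : Ioo (0 : ℝ) t = Ioi 0 ∩ Iio t := rfl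
  rw [h2, ← setIntegral_indicator measurableSet_Iio]
  refine setIntegral_congr_fun measurableSet_Ioi fun s _ => ?_
  simp only [indicator, mem_Iio]
  split_ifs with h
  · rw [hf _ (by linarith), ← mul_assoc (Real.exp (l * (t - s))), ← Real.exp_add]
    have h3 : Real.exp (-(l * t)) = Real.exp (-(l * s)) * Real.exp (-(l * (t - s))) := by
      rw [← Real.exp_add]; congr 1; ring
    rw [h3]
    simp only [add_neg_cancel, Real.exp_zero, one_mul]
    ring
  · simp

end weightedConv

theorem continuous_comp_max_zero {f : ℝ → ℝ} (hf : ContinuousOn f (Ici 0)) :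
    Continuous fun t => f (max t 0) :=
  hf.comp_continuous (by fun_prop) fun t => le_max_right t 0

/-- Existence and uniqueness of bounded-data Volterra equations with a bounded, globally Lipschitz
nonlinearity. -/
theorem volterra_exists_unique_of_lipschitz {κ G a : ℝ → ℝ} {C M R : ℝ}
    (hκ0 : ∀ s > 0, 0 ≤ κ s) (hκc : ContinuousOn κ (Ioi 0))
    (hκi : ∀ T > 0, IntegrableOn κ (Ioc 0 T)) (hdec : AntitoneOn κ (Ioi 0))
    (hG : Continuous G) (hM : ∀ x, |G x| ≤ M) (hC0 : 0 ≤ C)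
    (hC : ∀ x y, |G x - G y| ≤ C * |x - y|)
    (hac : ContinuousOn a (Ici 0)) (haR : ∀ t ≥ 0, |a t| ≤ R) :
    (∃ f : ℝ → ℝ, ContinuousOn f (Ici 0) ∧
      ∀ t ≥ 0, f t = a t + ∫ s in (0 : ℝ)..t, κ (t - s) * G (f s)) ∧
    ∀ (f g : ℝ → ℝ) (B : ℝ), ContinuousOn f (Ici 0) → ContinuousOn g (Ici 0) →
      (∀ t ≥ 0, |f t| ≤ B) → (∀ t ≥ 0, |g t| ≤ B) →
      (∀ t ≥ 0, f t = a t + ∫ s in (0 : ℝ)..t, κ (t - s) * G (f s)) →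
      (∀ t ≥ 0, g t = a t + ∫ s in (0 : ℝ)..t, κ (t - s) * G (g s)) →
      ∀ t ≥ 0, f t = g t := by
  obtain ⟨l, hlC, hl⟩ : ∃ l : ℝ,
      (∫ s in Ioi (0 : ℝ), κ s * Real.exp (-(l * s))) * C < 1 / 2 ∧ 0 < l := by
    have h := (laplace_tendsto_zero hκ0 hκc hκi hdec).mul_const C
    rw [zero_mul] at h
    exact ((h.eventually (gt_mem_nhds (by norm_num : (0 : ℝ) < 1 / 2))).and
      (eventually_gt_atTop 0)).exists
  have hexp : ∀ t : ℝ, 0 ≤ t → |Real.exp (-(l * t))| ≤ 1 := by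
    intro t ht
    rw [Real.abs_exp, Real.exp_le_one_iff]
    nlinarith
  have hwc : ∀ f : ℝ → ℝ, ContinuousOn f (Ici 0) →
      Continuous fun t => Real.exp (-(l * max t 0)) * f (max t 0) := fun f hf =>
    Continuous.mul (by fun_prop) (continuous_comp_max_zero hf)
  have hwb : ∀ (f : ℝ → ℝ) (B : ℝ), (∀ t ≥ 0, |f t| ≤ B) →
      ∀ t, ‖Real.exp (-(l * max t 0)) * f (max t 0)‖ ≤ B := by
    intro f B hf t
    rw [Real.norm_eq_abs, abs_mul, ← one_mul B]
    exact mul_le_mul (hexp _ (le_max_right _ _)) (hf _ (le_max_right _ _)) (abs_nonneg _)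
      zero_le_one
  let T : BoundedContinuousFunction ℝ ℝ → BoundedContinuousFunction ℝ ℝ := fun u =>
    BoundedContinuousFunction.ofNormedAddCommGroup
      (fun t => Real.exp (-(l * max t 0)) * a (max t 0) + weightedConv κ G l u t)
      ((hwc a hac).add (continuous_weightedConv hκ0 hκc hκi hdec hl hG hM u.continuous))
      (R + ∫ s in Ioi (0 : ℝ), κ s * Real.exp (-(l * s)) * M)
      (fun t => (norm_add_le _ _).trans (add_le_add (hwb a R haR t)
        (norm_weightedConv_le hκ0 hκc hκi hdec hl hM t)))
  have hT : ∀ u t, T u t = Real.exp (-(l * max t 0)) * a (max t 0) + weightedConv κ G l u t :=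
    fun u t => rfl
  have hcontr : ContractingWith (1 / 2) T := by
    refine ⟨by rw [← NNReal.coe_lt_coe]; norm_num, LipschitzWith.of_dist_le_mul fun u v => ?_⟩
    rw [BoundedContinuousFunction.dist_le (by positivity)]
    intro t
    rw [hT, hT, dist_add_left, Real.dist_eq]
    refine (dist_weightedConv_le hκ0 hκc hκi hdec hl hG hM hC0 hC u.continuous v.continuous
      (fun t => BoundedContinuousFunction.dist_coe_le_dist (f := u) (g := v) t) t).trans ?_
    rw [← mul_assoc]
    refine mul_le_mul_of_nonneg_right (hlC.le.trans_eq ?_) dist_nonneg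
    norm_num
  have hcancel : ∀ t : ℝ, Real.exp (-(l * t)) * Real.exp (l * t) = 1 := by
    intro t; rw [← Real.exp_add]; simp
  constructor
  · set u := ContractingWith.fixedPoint T hcontr
    have hu : T u = u := hcontr.fixedPoint_isFixedPt
    refine ⟨fun t => Real.exp (l * t) * u t, Continuous.continuousOn (by fun_prop), fun t ht => ?_⟩
    have h1 := hT u t
    rw [hu, max_eq_left ht, weightedConv_eq ht (f := fun t => Real.exp (l * t) * u t)
      (fun s _ => by rw [← mul_assoc, hcancel, one_mul]), ← mul_add] at h1
    change Real.exp (l * t) * u t = _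
    rw [h1, ← mul_assoc, mul_comm (Real.exp _), hcancel, one_mul]
  · intro f g B hf hg hfB hgB hfe hge t ht
    let W : ∀ f : ℝ → ℝ, ContinuousOn f (Ici 0) → (∀ t ≥ 0, |f t| ≤ B) →
        BoundedContinuousFunction ℝ ℝ := fun f hf hfB =>
      BoundedContinuousFunction.ofNormedAddCommGroup _ (hwc f hf) B (hwb f B hfB)
    have hW : ∀ f hf hfB t, W f hf hfB t = Real.exp (-(l * max t 0)) * f (max t 0) :=
      fun _ _ _ _ => rfl
    have hfix : ∀ f hf hfB,
        (∀ t ≥ 0, f t = a t + ∫ s in (0 : ℝ)..t, κ (t - s) * G (f s)) →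
        Function.IsFixedPt T (W f hf hfB) := by
      intro f hf hfB hfe
      refine BoundedContinuousFunction.ext fun t => ?_
      rw [hT, hW f hf hfB]
      rcases le_total 0 t with ht | ht
      · rw [weightedConv_eq ht (f := f) (fun s hs => by rw [hW f hf hfB, max_eq_left hs]),
          max_eq_left ht, ← mul_add, ← hfe t ht]
      · rw [weightedConv_of_nonpos ht, add_zero, max_eq_right ht]
        have := hfe 0 le_rfl
        rw [intervalIntegral.integral_same, add_zero] at this
        rw [this]
    have h := hcontr.fixedPoint_unique' (hfix f hf hfB hfe) (hfix g hg hgB hge)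
    have h2 := DFunLike.congr_fun h t
    rw [hW f hf hfB, hW g hg hgB, max_eq_left ht] at h2
    exact mul_left_cancel₀ (Real.exp_pos _).ne' h2

section reciprocalPrimitive

variable {wstar b : ℝ} {Hb : ℝ → ℝ}

theorem hasDerivAt_neg_integral_inv (hc : Continuous Hb) (hneg : ∀ w > wstar, Hb w < 0)
    (hb : wstar < b) {w : ℝ} (hw : wstar < w) :
    HasDerivAt (fun w => -∫ ζ in w..b, (Hb ζ)⁻¹) (Hb w)⁻¹ w := by
  have hco : ContinuousOn (fun ζ => (Hb ζ)⁻¹) (Ioi wstar) :=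
    hc.continuousOn.inv₀ fun ζ hζ => (hneg ζ hζ).ne
  have hsub : uIcc w b ⊆ Ioi wstar := fun x hx => (lt_min hw hb).trans_le hx.1
  have h := intervalIntegral.integral_hasDerivAt_left (hco.mono hsub).intervalIntegrable
    (hco.stronglyMeasurableAtFilter isOpen_Ioi w hw) (hco.continuousAt (Ioi_mem_nhds hw))
  exact h.neg.congr_deriv (neg_neg _)

theorem strictAntiOn_neg_integral_inv (hc : Continuous Hb) (hneg : ∀ w > wstar, Hb w < 0)
    (hb : wstar < b) : StrictAntiOn (fun w => -∫ ζ in w..b, (Hb ζ)⁻¹) (Ioi wstar) := by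
  refine strictAntiOn_of_deriv_neg (convex_Ioi _)
    (fun w hw => (hasDerivAt_neg_integral_inv hc hneg hb hw).continuousAt.continuousWithinAt)
    fun w hw => ?_
  rw [interior_Ioi] at hw
  rw [(hasDerivAt_neg_integral_inv hc hneg hb hw).deriv]
  exact inv_lt_zero.2 (hneg w hw)

theorem exists_neg_integral_inv_eq (hc : Continuous Hb) (hneg : ∀ w > wstar, Hb w < 0)
    (hb : wstar < b) {C : ℝ} (hC : 0 < C)
    (hlin : ∀ w ∈ Ioc wstar b, -Hb w ≤ C * (w - wstar)) {c : ℝ} (hc0 : 0 ≤ c) :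
    ∃ w ∈ Ioc wstar b, -∫ ζ in w..b, (Hb ζ)⁻¹ = c := by
  set E := Real.exp (-(C * c)) with hE
  have hE0 : 0 < E := Real.exp_pos _
  have hE1 : E ≤ 1 := by
    rw [hE, Real.exp_le_one_iff]; nlinarith
  have hbw : 0 < b - wstar := by linarith
  set v := wstar + (b - wstar) * E with hv
  have hwv : wstar < v := by
    have := mul_pos hbw hE0
    linarith
  have hvb : v ≤ b := by nlinarith
  have hco : ContinuousOn (fun ζ => (Hb ζ)⁻¹) (Ioi wstar) :=
    hc.continuousOn.inv₀ fun ζ hζ => (hneg ζ hζ).ne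
  have hsub : uIcc v b ⊆ Ioi wstar := fun x hx => (lt_min hwv hb).trans_le hx.1
  have hlog : ∫ ζ in v..b, (ζ - wstar)⁻¹ = C * c := by
    rw [intervalIntegral.integral_comp_sub_right (fun x => x⁻¹) wstar,
      integral_inv_of_pos (by linarith) hbw]
    have h1 : (b - wstar) / (v - wstar) = Real.exp (C * c) := by
      rw [hv, add_sub_cancel_left, div_mul_cancel_left₀ hbw.ne', hE, ← Real.exp_neg, neg_neg]
    rw [h1, Real.log_exp]
  have hge : c ≤ -∫ ζ in v..b, (Hb ζ)⁻¹ := by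
    have h2 : c = ∫ ζ in v..b, C⁻¹ * (ζ - wstar)⁻¹ := by
      rw [intervalIntegral.integral_const_mul, hlog, inv_mul_cancel_left₀ hC.ne']
    rw [h2, ← intervalIntegral.integral_neg]
    refine intervalIntegral.integral_mono_on hvb ?_ (hco.mono hsub).intervalIntegrable.neg ?_
    · refine ContinuousOn.intervalIntegrable (continuousOn_const.mul
        (ContinuousOn.inv₀ (by fun_prop) fun x hx => ?_))
      have : wstar < x := hsub hx
      linarith
    · intro x hx
      have hx1 : wstar < x := hwv.trans_le hx.1
      rw [← inv_neg, ← mul_inv]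
      exact inv_anti₀ (by linarith [hneg x hx1]) (hlin x ⟨hx1, hx.2⟩)
  have hcont : ContinuousOn (fun w => -∫ ζ in w..b, (Hb ζ)⁻¹) (Icc v b) := fun w hw =>
    (hasDerivAt_neg_integral_inv hc hneg hb
      (hwv.trans_le hw.1)).continuousAt.continuousWithinAt
  obtain ⟨w, hw, hwc⟩ := intermediate_value_Icc' hvb hcont ⟨by simpa using hc0, hge⟩
  exact ⟨w, ⟨hwv.trans_le hw.1, hw.2⟩, hwc⟩

end reciprocalPrimitive

theorem intervalIntegrable_zero_of_integrableOn_Ioc {κ : ℝ → ℝ}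
    (hκi : ∀ T > 0, IntegrableOn κ (Ioc 0 T)) {t : ℝ} (ht : 0 ≤ t) :
    IntervalIntegrable κ volume 0 t := by
  rw [intervalIntegrable_iff_integrableOn_Ioc_of_le ht]
  rcases ht.eq_or_lt with rfl | h
  · simp
  · exact hκi t h

theorem intervalIntegrable_comp_sub_left_zero {κ : ℝ → ℝ}
    (hκi : ∀ T > 0, IntegrableOn κ (Ioc 0 T)) {t : ℝ} (ht : 0 ≤ t) :
    IntervalIntegrable (fun s => κ (t - s)) volume 0 t := by
  have h := (intervalIntegrable_zero_of_integrableOn_Ioc hκi ht).comp_sub_left t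
  simpa using h.symm

/-- The lower bound for solutions of `f = a + κ ∗ h` when `h` is controlled by a decreasing
function of `f`: freezing the kernel at the terminal time `τ` dominates `f` by the solution of a
separable differential inequality. -/
theorem le_of_volterra_of_neg_integral_inv_eq {κ a f h Hb : ℝ → ℝ} {wstar τ r : ℝ}
    (hκ0 : ∀ s > 0, 0 ≤ κ s) (hκc : ContinuousOn κ (Ioi 0))
    (hκi : ∀ T > 0, IntegrableOn κ (Ioc 0 T)) (hdec : AntitoneOn κ (Ioi 0))
    (hamono : MonotoneOn a (Ici 0)) (ha0 : wstar < a 0)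
    (hHbc : Continuous Hb) (hHba : Antitone Hb) (hHbneg : ∀ w > wstar, Hb w < 0)
    (hτ : 0 < τ) (hh : ContinuousOn h (Icc 0 τ))
    (hf : ∀ t ∈ Icc 0 τ, f t = a t + ∫ s in (0 : ℝ)..t, κ (t - s) * h s)
    (hfw : ∀ t ∈ Ico 0 τ, wstar < f t) (hh0 : ∀ t ∈ Ico 0 τ, h t ≤ 0)
    (hhb : ∀ t ∈ Ico 0 τ, Hb (f t) ≤ h t) (hr : wstar < r)
    (hrQ : -∫ ζ in r..(a 0), (Hb ζ)⁻¹ = ∫ s in (0 : ℝ)..τ, κ s) : r ≤ f τ := by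
  set Q : ℝ → ℝ := fun w => -∫ ζ in w..(a 0), (Hb ζ)⁻¹ with hQdef
  have hQd : ∀ w > wstar, HasDerivAt Q (Hb w)⁻¹ w := fun w hw =>
    hasDerivAt_neg_integral_inv hHbc hHbneg ha0 hw
  have hQa : StrictAntiOn Q (Ioi wstar) := strictAntiOn_neg_integral_inv hHbc hHbneg ha0
  have hτm : τ ∈ Icc 0 τ := right_mem_Icc.2 hτ.le
  have hκτ : IntervalIntegrable (fun s => κ (τ - s)) volume 0 τ :=
    intervalIntegrable_comp_sub_left_zero hκi hτ.le
  have hk : IntervalIntegrable (fun s => κ (τ - s) * h s) volume 0 τ :=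
    hκτ.mul_continuousOn (by rwa [uIcc_of_le hτ.le])
  have hsubset : ∀ t ∈ Icc 0 τ, uIcc 0 t ⊆ uIcc 0 τ := fun t ht => by
    rw [uIcc_of_le ht.1, uIcc_of_le hτ.le]; exact Icc_subset_Icc_right ht.2
  set g : ℝ → ℝ := fun t => a τ + ∫ s in (0 : ℝ)..t, κ (τ - s) * h s with hg
  have hgτ : g τ = f τ := (hf τ hτm).symm
  have hfg : ∀ t ∈ Icc 0 τ, f t ≤ g t := by
    intro t ht
    rw [hf t ht]
    refine add_le_add (hamono ht.1 hτ.le ht.2) ?_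
    refine intervalIntegral.integral_mono_on_of_le_Ioo ht.1
      ((intervalIntegrable_comp_sub_left_zero hκi ht.1).mul_continuousOn ?_)
      (hk.mono_set (hsubset t ht)) ?_
    · rw [uIcc_of_le ht.1]; exact hh.mono (Icc_subset_Icc_right ht.2)
    · intro s hs
      refine mul_le_mul_of_nonpos_right ?_ (hh0 s ⟨hs.1.le, hs.2.trans_le ht.2⟩)
      have h1 : (0 : ℝ) < t - s := by linarith [hs.2]
      have h2 : (0 : ℝ) < τ - s := by linarith [hs.2, ht.2]
      exact hdec h1 h2 (by linarith [ht.2])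
  have hcoκ : ContinuousOn (fun s => κ (τ - s)) (Ioo 0 τ) :=
    hκc.comp (by fun_prop) fun s hs => by
      have := hs.2
      simp only [mem_Ioi]; linarith
  have hprim : ∀ p : ℝ → ℝ, IntervalIntegrable p volume 0 τ → ContinuousOn p (Ioo 0 τ) →
      ∀ t ∈ Ioo 0 τ, HasDerivAt (fun t => ∫ s in (0 : ℝ)..t, p s) (p t) t := by
    intro p hp hpc t ht
    exact intervalIntegral.integral_hasDerivAt_right
      (hp.mono_set (hsubset t ⟨ht.1.le, ht.2.le⟩))
      (hpc.stronglyMeasurableAtFilter isOpen_Ioo t ht)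
      (hpc.continuousAt (isOpen_Ioo.mem_nhds ht))
  have hprimc : ∀ p : ℝ → ℝ, IntervalIntegrable p volume 0 τ →
      ContinuousOn (fun t => ∫ s in (0 : ℝ)..t, p s) (Icc 0 τ) := by
    intro p hp
    have := intervalIntegral.continuousOn_primitive_interval' hp left_mem_uIcc
    rwa [uIcc_of_le hτ.le] at this
  have hgc : ContinuousOn g (Icc 0 τ) := continuousOn_const.add (hprimc _ hk)
  have hgd : ∀ t ∈ Ioo 0 τ, HasDerivAt g (κ (τ - t) * h t) t := fun t ht =>
    (hprim _ hk (hcoκ.mul (hh.mono Ioo_subset_Icc_self)) t ht).const_add _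
  have hgw : ∀ t ∈ Ico 0 τ, wstar < g t := fun t ht =>
    (hfw t ht).trans_le (hfg t ⟨ht.1, ht.2.le⟩)
  have hKτ : ∫ s in (0 : ℝ)..τ, κ (τ - s) = ∫ s in (0 : ℝ)..τ, κ s := by
    simp [intervalIntegral.integral_comp_sub_left]
  have hrg : ∀ t ∈ Ico 0 τ, r ≤ g t := by
    intro t ht
    have hanti : AntitoneOn (fun s => Q (g s) - ∫ x in (0 : ℝ)..s, κ (τ - x)) (Icc 0 t) := by
      have hd : ∀ s ∈ Ioo 0 t, HasDerivAt (fun s => Q (g s) - ∫ x in (0 : ℝ)..s, κ (τ - x))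
          ((Hb (g s))⁻¹ * (κ (τ - s) * h s) - κ (τ - s)) s := by
        intro s hs
        have hs' : s ∈ Ioo 0 τ := ⟨hs.1, hs.2.trans ht.2⟩
        exact ((hQd _ (hgw s ⟨hs.1.le, hs'.2⟩)).comp s (hgd s hs')).sub (hprim _ hκτ hcoκ s hs')
      refine antitoneOn_of_deriv_nonpos (convex_Icc _ _) ?_ ?_ ?_
      · refine ContinuousOn.sub ?_ ((hprimc _ hκτ).mono (Icc_subset_Icc_right ht.2.le))
        intro s hs
        exact (hQd _ (hgw s ⟨hs.1, hs.2.trans_lt ht.2⟩)).continuousAt.comp_continuousWithinAt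
          ((hgc.mono (Icc_subset_Icc_right ht.2.le)) s hs)
      · rw [interior_Icc]
        exact fun s hs => (hd s hs).differentiableAt.differentiableWithinAt
      · rw [interior_Icc]
        intro s hs
        rw [(hd s hs).deriv]
        have hsI : s ∈ Ico 0 τ := ⟨hs.1.le, hs.2.trans ht.2⟩
        have hH : Hb (g s) < 0 := hHbneg _ (hgw s hsI)
        have hle : (Hb (g s))⁻¹ * h s ≤ 1 := by
          rw [← inv_mul_cancel₀ hH.ne]
          exact mul_le_mul_of_nonpos_left
            ((hHba (hfg s ⟨hsI.1, hsI.2.le⟩)).trans (hhb s hsI)) (inv_lt_zero.2 hH).le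
        have hκs : 0 ≤ κ (τ - s) := hκ0 _ (by linarith [hsI.2])
        nlinarith
    have h1 := hanti (left_mem_Icc.2 ht.1) (right_mem_Icc.2 ht.1) ht.1
    simp only [intervalIntegral.integral_same, sub_zero] at h1
    have h2 : Q (g 0) ≤ Q (a 0) := by
      have hga : a 0 ≤ g 0 := by
        simp only [hg, intervalIntegral.integral_same, add_zero]
        exact hamono (mem_Ici.2 le_rfl) hτ.le hτ.le
      exact hQa.antitoneOn ha0 (ha0.trans_le hga) hga
    have h3 : Q (a 0) = 0 := by simp [hQdef]
    have h4 : ∫ x in (0 : ℝ)..t, κ (τ - x) ≤ ∫ x in (0 : ℝ)..τ, κ (τ - x) := by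
      refine intervalIntegral.integral_mono_interval le_rfl ht.1 ht.2.le ?_ hκτ
      rw [← Measure.restrict_congr_set Ioo_ae_eq_Ioc]
      refine (ae_restrict_mem measurableSet_Ioo).mono fun x hx => ?_
      exact hκ0 _ (by linarith [hx.2])
    by_contra! hlt
    have h5 := hQa (hgw t ht) hr hlt
    have h6 : Q r = ∫ s in (0 : ℝ)..τ, κ s := hrQ
    linarith
  rw [← hgτ]
  have hcw : Tendsto g (nhdsWithin τ (Ico 0 τ)) (nhds (g τ)) :=
    (hgc τ hτm).mono_left (nhdsWithin_mono _ Ico_subset_Icc_self)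
  have hne : (nhdsWithin τ (Ico 0 τ)).NeBot := by
    rw [nhdsWithin_Ico_eq_nhdsLT hτ]; infer_instance
  exact ge_of_tendsto hcw (eventually_mem_nhdsWithin.mono hrg)

namespace AssumptionH

variable {wmax wstar w0 : ℝ} {H : ℝ → ℝ}

theorem continuousOn (hH : AssumptionH wmax wstar H) : ContinuousOn H (Iic wmax) :=
  hH.2.1.continuousOn

theorem lt (hH : AssumptionH wmax wstar H) : wstar < wmax := by
  refine lt_of_le_of_ne hH.1 ?_
  rintro rfl
  exact hH.2.2.2.2.2.2.ne hH.2.2.2.1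

theorem neg (hH : AssumptionH wmax wstar H) {w : ℝ} (hw : w ∈ Ioc wstar wmax) : H w < 0 := by
  by_contra! h
  obtain ⟨c, hc, hc0⟩ := intermediate_value_Icc' hw.2
    (hH.continuousOn.mono fun x hx => hx.2) ⟨hH.2.2.2.2.2.2.le, h⟩
  exact (hw.1.trans_le hc.1).ne' (hH.2.2.2.2.1 c hc.2 hc0)

theorem lt_minimizer (hH : AssumptionH wmax wstar H) (hw0 : w0 ≤ wmax)
    (hw0min : ∀ w ∈ Iic wmax, H w0 ≤ H w) : wstar < w0 := by
  have h0 : H w0 < 0 := (hw0min wmax (mem_Iic.2 le_rfl)).trans_lt hH.2.2.2.2.2.2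
  by_contra! h
  have hseg : wstar ∈ segment ℝ w0 wmax := by
    rw [segment_eq_Icc hw0]; exact ⟨h, hH.1⟩
  have := hH.2.2.1.le_on_segment hw0 (mem_Iic.2 le_rfl) hseg
  rw [hH.2.2.2.1] at this
  exact absurd this (not_le.2 (max_lt h0 hH.2.2.2.2.2.2))

theorem antitoneOn (hH : AssumptionH wmax wstar H) (hw0 : w0 ≤ wmax)
    (hw0min : ∀ w ∈ Iic wmax, H w0 ≤ H w) : AntitoneOn H (Iic w0) := by
  intro x hx y hy hxy
  have hx1 : x ≤ w0 := hx
  have hseg : y ∈ segment ℝ x w0 := by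
    rw [segment_eq_Icc hx1]; exact ⟨hxy, hy⟩
  have := hH.2.2.1.le_on_segment (hx1.trans hw0) hw0 hseg
  rwa [max_eq_left (hw0min x (hx1.trans hw0))] at this

theorem continuous_envelope (hH : AssumptionH wmax wstar H) (hw0 : w0 ≤ wmax) :
    Continuous fun w => H (min w w0) :=
  hH.continuousOn.comp_continuous (by fun_prop) fun _ => (min_le_right _ _).trans hw0

theorem antitone_envelope (hH : AssumptionH wmax wstar H) (hw0 : w0 ≤ wmax)
    (hw0min : ∀ w ∈ Iic wmax, H w0 ≤ H w) : Antitone fun w => H (min w w0) := fun _ _ hxy =>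
  hH.antitoneOn hw0 hw0min (mem_Iic.2 (min_le_right _ _)) (mem_Iic.2 (min_le_right _ _))
    (min_le_min_right _ hxy)

theorem envelope_neg (hH : AssumptionH wmax wstar H) (hw0 : w0 ≤ wmax)
    (hw0min : ∀ w ∈ Iic wmax, H w0 ≤ H w) {w : ℝ} (hw : wstar < w) : H (min w w0) < 0 :=
  hH.neg ⟨lt_min hw (hH.lt_minimizer hw0 hw0min), (min_le_right _ _).trans hw0⟩

theorem exists_lipschitzOnWith (hH : AssumptionH wmax wstar H) :
    ∃ K, LipschitzOnWith K H (Icc wstar wmax) :=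
  (hH.2.1.mono Icc_subset_Iic_self).exists_lipschitzOnWith one_ne_zero (convex_Icc _ _)
    isCompact_Icc

theorem exists_envelope_linear_bound (hH : AssumptionH wmax wstar H) (hw0 : w0 ≤ wmax)
    (hw0min : ∀ w ∈ Iic wmax, H w0 ≤ H w) :
    ∃ C > 0, ∀ w > wstar, -H (min w w0) ≤ C * (w - wstar) := by
  obtain ⟨K, hK⟩ := hH.exists_lipschitzOnWith
  refine ⟨K + 1, by positivity, fun w hw => ?_⟩
  have hm : wstar < min w w0 := lt_min hw (hH.lt_minimizer hw0 hw0min)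
  have h := hK.dist_le_mul _ ⟨hm.le, (min_le_right w w0).trans hw0⟩ _ (left_mem_Icc.2 hH.1)
  rw [hH.2.2.2.1, Real.dist_eq, Real.dist_eq, sub_zero, abs_of_pos (sub_pos.2 hm)] at h
  have h1 := min_le_left w w0
  calc -H (min w w0) ≤ K * (min w w0 - wstar) := (neg_le_abs _).trans h
    _ ≤ K * (w - wstar) := mul_le_mul_of_nonneg_left (by linarith) K.2
    _ ≤ (K + 1) * (w - wstar) := mul_le_mul_of_nonneg_right (by linarith) (by linarith)

end AssumptionH

theorem forall_lt_of_first_exit {f : ℝ → ℝ} {c : ℝ} (hf : ContinuousOn f (Ici 0)) (h0 : c < f 0)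
    (hstep : ∀ τ > 0, (∀ t ∈ Ico 0 τ, c < f t) → c < f τ) : ∀ t ≥ 0, c < f t := by
  intro T hT
  by_contra! hle
  have hclosed : IsClosed (Icc 0 T ∩ f ⁻¹' Iic c) :=
    (hf.mono Icc_subset_Ici_self).preimage_isClosed_of_isClosed isClosed_Icc isClosed_Iic
  have hcomp : IsCompact (Icc 0 T ∩ f ⁻¹' Iic c) :=
    isCompact_Icc.of_isClosed_subset hclosed inter_subset_left
  obtain ⟨τ, hτ, hmin⟩ := hcomp.exists_isLeast ⟨T, ⟨hT, le_rfl⟩, hle⟩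
  have hτc : f τ ≤ c := hτ.2
  have hτ0 : 0 < τ := by
    refine lt_of_le_of_ne hτ.1.1 ?_
    rintro rfl
    exact absurd hτc (not_le.2 h0)
  refine absurd hτc (not_le.2 (hstep τ hτ0 fun t ht => ?_))
  by_contra! htc
  exact absurd (hmin ⟨⟨ht.1, ht.2.le.trans hτ.1.2⟩, htc⟩) (not_le.2 ht.2)

theorem intervalIntegral_nonpos_of_nonpos {p : ℝ → ℝ} {b c : ℝ} (hbc : b ≤ c)
    (hp : ∀ s ∈ Icc b c, p s ≤ 0) : ∫ s in b..c, p s ≤ 0 := by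
  have h := intervalIntegral.integral_nonneg (f := fun s => -p s) (μ := volume) hbc
    fun s hs => neg_nonneg.2 (hp s hs)
  rw [intervalIntegral.integral_neg] at h
  linarith

theorem integral_convolution_neg {κ h : ℝ → ℝ} (hκ0 : ∀ s > 0, 0 ≤ κ s)
    (hκi : ∀ T > 0, IntegrableOn κ (Ioc 0 T)) (hdec : AntitoneOn κ (Ioi 0))
    (hne : ∃ t > 0, κ t ≠ 0) {t : ℝ} (ht : 0 < t) (hh : ContinuousOn h (Icc 0 t))
    (hneg : ∀ s ∈ Icc 0 t, h s < 0) : ∫ s in (0 : ℝ)..t, κ (t - s) * h s < 0 := by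
  obtain ⟨δ, hδ, hκδ⟩ := hne
  have hint : IntervalIntegrable (fun s => κ (t - s) * h s) volume 0 t :=
    (intervalIntegrable_comp_sub_left_zero hκi ht.le).mul_continuousOn
      (by rwa [uIcc_of_le ht.le])
  set c := max 0 (t - δ) with hc
  have hc0 : 0 ≤ c := le_max_left _ _
  have hct : c < t := max_lt ht (by linarith)
  have hint1 : IntervalIntegrable (fun s => κ (t - s) * h s) volume 0 c :=
    hint.mono_set (by
      rw [uIcc_of_le hc0, uIcc_of_le ht.le]; exact Icc_subset_Icc_right hct.le)
  have hint2 : IntervalIntegrable (fun s => κ (t - s) * h s) volume c t :=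
    hint.mono_set (by
      rw [uIcc_of_le hct.le, uIcc_of_le ht.le]; exact Icc_subset_Icc_left hc0)
  rw [← intervalIntegral.integral_add_adjacent_intervals hint1 hint2]
  have h1 : ∫ s in (0 : ℝ)..c, κ (t - s) * h s ≤ 0 := by
    refine intervalIntegral_nonpos_of_nonpos hc0 fun s hs => ?_
    exact mul_nonpos_of_nonneg_of_nonpos (hκ0 _ (by linarith [hs.2]))
      (hneg s ⟨hs.1, hs.2.trans hct.le⟩).le
  have h2 : 0 < ∫ s in c..t, -(κ (t - s) * h s) := by
    refine intervalIntegral.intervalIntegral_pos_of_pos_on hint2.neg (fun s hs => ?_) hct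
    have hts : 0 < t - s := by linarith [hs.2]
    have hsδ : t - s ≤ δ := by linarith [hs.1, le_max_right 0 (t - δ)]
    have hκs : 0 < κ (t - s) :=
      ((hκ0 δ hδ).lt_of_ne' hκδ).trans_le (hdec hts hδ hsδ)
    have := mul_neg_of_pos_of_neg hκs (hneg s ⟨hc0.trans hs.1.le, hs.2.le⟩)
    linarith
  rw [intervalIntegral.integral_neg] at h2
  linarith

/-- Theorem (Volterra, case (a')): for `H` satisfying Assumption (H) with leftmost
minimizer `w₀` and decreasing envelope `H̄` (equal to `H` on `(−∞,w₀]` and to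
`H(w₀)` on `[w₀, w_max]`), a decreasing `L₁`-kernel `κ` not identically zero, and a
continuous increasing `a : [0,∞) → (w_*, w_max]`, the Volterra equation
`f(t) = a(t) + ∫₀^t κ(t−s) H(f(s)) ds` has a unique global continuous solution,
satisfying `w_* < Q̄₁⁻¹(∫₀^t κ, a(0)) ≤ f(t) < a(t)` for `t > 0`, where
`Q̄₁(w,a₀) = −∫_w^{a₀} dζ/H̄(ζ)`. -/
theorem volterra_case_a'
    (wmax wstar w0 : ℝ) (H : ℝ → ℝ) (hH : AssumptionH wmax wstar H)
    (hw0 : w0 ≤ wmax)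
    (hw0min : ∀ w ∈ Set.Iic wmax, H w0 ≤ H w)
    (hw0left : ∀ w ∈ Set.Iic wmax, H w = H w0 → w0 ≤ w)
    (κ : ℝ → ℝ) (hκ : IsLpKernel 1 κ) (hdec : AntitoneOn κ (Set.Ioi 0))
    (hne : ∃ t > 0, κ t ≠ 0)
    (a : ℝ → ℝ) (hacont : ContinuousOn a (Set.Ici 0))
    (hamono : MonotoneOn a (Set.Ici 0))
    (haval : ∀ t ≥ 0, a t ∈ Set.Ioc wstar wmax) :
    let Hbar : ℝ → ℝ := fun w => if w ≤ w0 then H w else H w0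
    let Q1bar : ℝ → ℝ := fun w => -∫ ζ in w..(a 0), (Hbar ζ)⁻¹
    let r1bar : ℝ → ℝ := fun t =>
      Function.invFunOn Q1bar (Set.Ioc wstar (a 0)) (∫ s in (0:ℝ)..t, κ s)
    ∃ f : ℝ → ℝ,
      (ContinuousOn f (Set.Ici 0) ∧ (∀ t ≥ 0, f t ≤ wmax) ∧
        (∀ t ≥ 0, f t = a t + ∫ s in (0:ℝ)..t, κ (t - s) * H (f s))) ∧
      (∀ f' : ℝ → ℝ,
        (ContinuousOn f' (Set.Ici 0) ∧ (∀ t ≥ 0, f' t ≤ wmax) ∧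
          (∀ t ≥ 0, f' t = a t + ∫ s in (0:ℝ)..t, κ (t - s) * H (f' s))) →
        ∀ t ≥ 0, f' t = f t) ∧
      (∀ t > 0, wstar < r1bar t ∧ r1bar t ≤ f t ∧ f t < a t) := by
  intro Hbar Q1bar r1bar
  have hκ0 : ∀ s > 0, 0 ≤ κ s := fun s hs => hκ.1 s (le_of_lt hs)
  have hκc := hκ.2.1
  have hκi : ∀ T > 0, IntegrableOn κ (Ioc 0 T) := fun T hT => by simpa using hκ.2.2 T hT
  have hHbar : Hbar = fun w => H (min w w0) := by
    funext w
    simp only [Hbar, min_def]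
    split_ifs <;> rfl
  have ha0 : a 0 ∈ Ioc wstar wmax := haval 0 le_rfl
  have hHbc : Continuous Hbar := hHbar ▸ hH.continuous_envelope hw0
  have hHba : Antitone Hbar := hHbar ▸ hH.antitone_envelope hw0 hw0min
  have hHbneg : ∀ w > wstar, Hbar w < 0 := fun w hw => by
    rw [hHbar]; exact hH.envelope_neg hw0 hw0min hw
  have hHble : ∀ w ≤ wmax, Hbar w ≤ H w := fun w hw => by
    simp only [Hbar]
    split_ifs
    · exact le_rfl
    · exact hw0min w hw
  have hr1 : ∀ t ≥ 0, r1bar t ∈ Ioc wstar (a 0) ∧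
      Q1bar (r1bar t) = ∫ s in (0 : ℝ)..t, κ s := by
    intro t ht
    obtain ⟨C, hC, hlin⟩ := hH.exists_envelope_linear_bound hw0 hw0min
    have hex : ∃ w ∈ Ioc wstar (a 0), Q1bar w = ∫ s in (0 : ℝ)..t, κ s :=
      exists_neg_integral_inv_eq hHbc hHbneg ha0.1 hC
        (fun w hw => by rw [hHbar]; exact hlin w hw.1)
        (intervalIntegral.integral_nonneg ht fun s hs => hκ.1 s hs.1)
    exact ⟨Function.invFunOn_mem hex, Function.invFunOn_eq hex⟩
  have hlower : ∀ f h : ℝ → ℝ, ∀ τ > 0, ContinuousOn h (Icc 0 τ) →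
      (∀ t ∈ Icc 0 τ, f t = a t + ∫ s in (0 : ℝ)..t, κ (t - s) * h s) →
      (∀ t ∈ Ico 0 τ, wstar < f t) → (∀ t ≥ 0, f t ≤ wmax) →
      (∀ t ∈ Ico 0 τ, h t = H (f t)) → r1bar τ ≤ f τ := by
    intro f h τ hτ hh hf hfw hfm hhH
    refine le_of_volterra_of_neg_integral_inv_eq hκ0 hκc hκi hdec hamono ha0.1 hHbc hHba hHbneg
      hτ hh hf hfw (fun t ht => ?_) (fun t ht => ?_) (hr1 τ hτ.le).1.1 (hr1 τ hτ.le).2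
    · rw [hhH t ht]
      exact (hH.neg ⟨hfw t ht, hfm t ht.1⟩).le
    · rw [hhH t ht]
      exact hHble _ (hfm t ht.1)
  -- the truncation of `H` to `[wstar, wmax]` is bounded and globally Lipschitz
  set G : ℝ → ℝ := fun x => H (projIcc wstar wmax hH.1 x) with hGdef
  have hGH : ∀ x ∈ Icc wstar wmax, G x = H x := fun x hx => by
    simp only [hGdef, projIcc_of_mem hH.1 hx]
  have hG0 : ∀ x, G x ≤ 0 := by
    intro x
    rcases (projIcc wstar wmax hH.1 x).2.1.eq_or_lt with h | h
    · simp only [hGdef, ← h, hH.2.2.2.1, le_rfl]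
    · exact (hH.neg ⟨h, (projIcc wstar wmax hH.1 x).2.2⟩).le
  obtain ⟨K, hK⟩ := hH.exists_lipschitzOnWith
  obtain ⟨M, hM⟩ := isCompact_Icc.exists_bound_of_continuousOn hK.continuousOn
  have hGl : ∀ x y, |G x - G y| ≤ K * |x - y| := by
    intro x y
    have h1 := hK.dist_le_mul _ (projIcc wstar wmax hH.1 x).2 _ (projIcc wstar wmax hH.1 y).2
    have h2 := (LipschitzWith.projIcc hH.1).dist_le_mul x y
    rw [NNReal.coe_one, one_mul] at h2
    exact h1.trans (mul_le_mul_of_nonneg_left h2 K.2)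
  have hGc : Continuous G :=
    hK.continuousOn.comp_continuous (continuous_subtype_val.comp continuous_projIcc)
      fun x => (projIcc wstar wmax hH.1 x).2
  obtain ⟨⟨f, hfc, hfe⟩, huniq⟩ := volterra_exists_unique_of_lipschitz hκ0 hκc hκi hdec hGc
    (fun x => hM _ (projIcc wstar wmax hH.1 x).2) K.2 hGl hacont
    (fun t ht => abs_le_max_abs_abs (haval t ht).1.le (haval t ht).2)
  have hfm : ∀ t ≥ 0, f t ≤ wmax := by
    intro t ht
    rw [hfe t ht]
    have : ∫ s in (0 : ℝ)..t, κ (t - s) * G (f s) ≤ 0 :=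
      intervalIntegral_nonpos_of_nonpos ht fun s hs =>
        mul_nonpos_of_nonneg_of_nonpos (hκ.1 _ (by linarith [hs.2])) (hG0 _)
    linarith [(haval t ht).2]
  have hstart : ∀ f h : ℝ → ℝ,
      (∀ t ≥ 0, f t = a t + ∫ s in (0 : ℝ)..t, κ (t - s) * h s) → wstar < f 0 := by
    intro f h hf
    rw [hf 0 le_rfl, intervalIntegral.integral_same, add_zero]
    exact ha0.1
  have hflow : ∀ τ > 0, (∀ t ∈ Ico 0 τ, wstar < f t) → r1bar τ ≤ f τ := fun τ hτ hfw =>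
    hlower f (fun s => G (f s)) τ hτ
      (hGc.comp_continuousOn (hfc.mono Icc_subset_Ici_self)) (fun t ht => hfe t ht.1) hfw hfm
      fun t ht => hGH _ ⟨(hfw t ht).le, hfm t ht.1⟩
  have hfw : ∀ t ≥ 0, wstar < f t :=
    forall_lt_of_first_exit hfc (hstart f (fun s => G (f s)) hfe) fun τ hτ h =>
      (hr1 τ hτ.le).1.1.trans_le (hflow τ hτ h)
  have hcongr : ∀ f : ℝ → ℝ, (∀ t ≥ 0, wstar < f t) → (∀ t ≥ 0, f t ≤ wmax) → ∀ t ≥ 0,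
      ∫ s in (0 : ℝ)..t, κ (t - s) * G (f s) = ∫ s in (0 : ℝ)..t, κ (t - s) * H (f s) := by
    intro f hfw hfm t ht
    refine intervalIntegral.integral_congr fun s hs => ?_
    rw [uIcc_of_le ht] at hs
    simp only [hGH _ ⟨(hfw s hs.1).le, hfm s hs.1⟩]
  have hHf : ∀ f : ℝ → ℝ, ContinuousOn f (Ici 0) → (∀ t ≥ 0, f t ≤ wmax) → ∀ t,
      ContinuousOn (fun s => H (f s)) (Icc 0 t) := fun f hfc hfm t =>
    hH.continuousOn.comp (hfc.mono Icc_subset_Ici_self) fun s hs => hfm s hs.1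
  have hfeH : ∀ t ≥ 0, f t = a t + ∫ s in (0 : ℝ)..t, κ (t - s) * H (f s) := fun t ht => by
    rw [← hcongr f hfw hfm t ht]; exact hfe t ht
  refine ⟨f, ⟨hfc, hfm, hfeH⟩, ?_, ?_⟩
  · rintro f' ⟨hfc', hfm', hfe'⟩ t ht
    have hfw' : ∀ t ≥ 0, wstar < f' t :=
      forall_lt_of_first_exit hfc' (hstart f' (fun s => H (f' s)) hfe') fun τ hτ h =>
        (hr1 τ hτ.le).1.1.trans_le (hlower f' (fun s => H (f' s)) τ hτ (hHf f' hfc' hfm' τ)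
          (fun t ht => hfe' t ht.1) h hfm' fun _ _ => rfl)
    exact huniq f' f (max |wstar| |wmax|) hfc' hfc
      (fun t ht => abs_le_max_abs_abs (hfw' t ht).le (hfm' t ht))
      (fun t ht => abs_le_max_abs_abs (hfw t ht).le (hfm t ht))
      (fun t ht => by rw [hcongr f' hfw' hfm' t ht]; exact hfe' t ht) hfe t ht
  · intro t ht
    refine ⟨(hr1 t ht.le).1.1, hflow t ht fun s hs => hfw s hs.1, ?_⟩
    have hlt := integral_convolution_neg hκ0 hκi hdec hne ht (hHf f hfc hfm t)
      fun s hs => hH.neg ⟨hfw s hs.1, hfm s hs.1⟩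
    have := hfeH t ht.le
    linarith
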